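/- Assume k = ℂ and Q, q are generic. Then for all m, n ≥ 2d, the type B Schur algebras S^B_{Q,q}(m; d) and S^B_{Q,q}(n; d) are Morita equivalent, i.e. their categories of modules are equivalent. -/

import Mathlib

noncomputable section
namespace QSP

variable {k : Type*} [Field k]

/-- Doubled value of a basis index: `val n j = 2*j - (n-1)`, so that the basis
indices of `V_n` are the integers/half-integers `val/2` in `𝕀_n`. -/
def val (n : ℕ) (j : Fin n) : ℤ := 2 * (j : ℤ) - ((n : ℤ) - 1)

/-- Matrix of the operator `K_Q` on `V_n` in the standard basis. -/
def KQmat (Q : k) (n : ℕ) : Matrix (Fin n) (Fin n) k := fun c b =>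
  if val n b = 0 then (if c = b then Q⁻¹ else 0)
  else (if c = Fin.rev b then 1 else 0) + (if val n b < 0 ∧ c = b then Q⁻¹ - Q else 0)

/-- Matrix of the operator `R_q` on `V_n ⊗ V_n` in the standard basis. -/
def Rmat (q : k) (n : ℕ) : Matrix (Fin n × Fin n) (Fin n × Fin n) k := fun c b =>
  if b.1 = b.2 then (if c = b then q⁻¹ else 0)
  else if b.1 < b.2 then (if c = (b.2, b.1) then 1 else 0)
  else (if c = (b.2, b.1) then 1 else 0) + (if c = b then q⁻¹ - q else 0)

/-- The operators `T_i`, `0 ≤ i ≤ d-1`, on `V_n^{⊗ d}`; `T_0` acts as `K_Q` on the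
first tensor factor, and `T_i` (for `i > 0`) acts as `R_q` on the `(i, i+1)`
tensor factors (1-based). -/
def TB (Q q : k) (n d : ℕ) (i : ℕ) : Module.End k ((Fin d → Fin n) → k) :=
  if _h0 : i = 0 then
    if hd : 0 < d then
      Matrix.toLin' (fun c b =>
        if ∀ j, j ≠ (⟨0, hd⟩ : Fin d) → c j = b j then
          KQmat Q n (c ⟨0, hd⟩) (b ⟨0, hd⟩) else 0)
    else 0
  else if hi : i < d then
    Matrix.toLin' (fun c b =>
      if ∀ j, j ≠ (⟨i - 1, Nat.lt_of_le_of_lt (Nat.pred_le i) hi⟩ : Fin d) →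
          j ≠ (⟨i, hi⟩ : Fin d) → c j = b j then
        Rmat q n (c ⟨i - 1, Nat.lt_of_le_of_lt (Nat.pred_le i) hi⟩, c ⟨i, hi⟩)
          (b ⟨i - 1, Nat.lt_of_le_of_lt (Nat.pred_le i) hi⟩, b ⟨i, hi⟩) else 0)
  else 0

/-- The Jucys–Murphy elements `K_i = T_{i-1} ⋯ T_1 T_0 T_1 ⋯ T_{i-1}` acting on
`V_n^{⊗ d}`, for `1 ≤ i ≤ d` (junk value `1` for `i = 0`). -/
def JM (Q q : k) (n d : ℕ) : ℕ → Module.End k ((Fin d → Fin n) → k)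
  | 0 => 1
  | 1 => TB Q q n d 0
  | i + 2 => TB Q q n d (i + 1) * JM Q q n d (i + 1) * TB Q q n d (i + 1)

/-- The element `c_K = K_1 K_2 ⋯ K_d` acting on `V_n^{⊗ d}`. -/
def cK (Q q : k) (n d : ℕ) : Module.End k ((Fin d → Fin n) → k) :=
  ((List.range d).map (fun i => JM Q q n d (i + 1))).prod


/-- The type B Schur algebra `S^B_{Q,q}(n; d)`: the subalgebra of
`End(V_n^{⊗d})` of all endomorphisms commuting with `T_0, …, T_{d-1}`. -/
def schurB (Q q : k) (n d : ℕ) : Subalgebra k (Module.End k ((Fin d → Fin n) → k)) :=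
  Subalgebra.centralizer k (TB Q q n d '' Set.Iio d)

/-! ### Abstract Morita theory -/
section Morita
open CategoryTheory

variable {k : Type} [Field k] {ι : Type} (I : Set ι)
variable {M M' M'' : Type} [AddCommGroup M] [Module k M] [AddCommGroup M'] [Module k M']
  [AddCommGroup M''] [Module k M'']

/-- Intertwiners. -/
def Itw (T : ι → Module.End k M) (T' : ι → Module.End k M') : AddSubgroup (M →ₗ[k] M') where
  carrier := {f | ∀ i ∈ I, f ∘ₗ T i = T' i ∘ₗ f}
  zero_mem' := by intro i _; simp
  add_mem' := by
    intro a b ha hb i hi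
    simp only [Set.mem_ofPred_eq] at ha hb
    rw [LinearMap.add_comp, LinearMap.comp_add, ha i hi, hb i hi]
  neg_mem' := by
    intro a ha i hi
    simp only [Set.mem_ofPred_eq] at ha
    rw [LinearMap.neg_comp, LinearMap.comp_neg, ha i hi]

/-- centralizer -/
abbrev Cen (T : ι → Module.End k M) : Subalgebra k (Module.End k M) :=
  Subalgebra.centralizer k (T '' I)

variable {I} {T : ι → Module.End k M} {T' : ι → Module.End k M'} {T'' : ι → Module.End k M''}

theorem Itw.comp_mem {f : M →ₗ[k] M'} {g : M' →ₗ[k] M''} (hg : g ∈ Itw I T' T'')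
    (hf : f ∈ Itw I T T') : g ∘ₗ f ∈ Itw I T T'' := by
  intro i hi
  rw [LinearMap.comp_assoc, hf i hi, ← LinearMap.comp_assoc, hg i hi, LinearMap.comp_assoc]

/-- composition -/
def icomp (g : Itw I T' T'') (f : Itw I T T') : Itw I T T'' :=
  ⟨g.1 ∘ₗ f.1, Itw.comp_mem g.2 f.2⟩

theorem mem_Cen_iff {f : Module.End k M} : f ∈ Cen I T ↔ f ∈ Itw I T T := by
  rw [Subalgebra.mem_centralizer_iff]
  constructor
  · intro h i hi
    exact (h _ ⟨i, hi, rfl⟩).symm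
  · rintro h _ ⟨i, hi, rfl⟩
    exact (h i hi).symm

/-- centralizer element to intertwiner -/
def toI (s : Cen I T) : Itw I T T := ⟨s.1, mem_Cen_iff.1 s.2⟩
/-- converse -/
def ofI (s : Itw I T T) : Cen I T := ⟨s.1, mem_Cen_iff.2 s.2⟩

/-- The Hom functor on objects. -/
def HM (I : Set ι) (T : ι → Module.End k M) (T' : ι → Module.End k M') (N : Type)
    [AddCommGroup N] [Module (Cen I T) N] : AddSubgroup (Itw I T' T →+ N) where
  carrier := {φ | ∀ (s : Cen I T) (p : Itw I T' T), φ (icomp (toI s) p) = s • φ p}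
  zero_mem' := by intro s p; simp
  add_mem' := by intro a b ha hb s p; simp [ha s p, hb s p]
  neg_mem' := by intro a ha s p; simp [ha s p]

/-- precomposition -/
def preI (s : Cen I T') : Itw I T' T →+ Itw I T' T where
  toFun p := icomp p (toI s)
  map_zero' := by ext; rfl
  map_add' a b := by ext; rfl

instance (N : Type) [AddCommGroup N] [Module (Cen I T) N] : Module (Cen I T') (HM I T T' N) where
  smul s φ := ⟨φ.1.comp (preI s), fun t p => φ.2 t (icomp p (toI s))⟩
  one_smul φ := by apply Subtype.ext; apply AddMonoidHom.ext; intro p; rfl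
  mul_smul a b φ := by apply Subtype.ext; apply AddMonoidHom.ext; intro p; rfl
  smul_zero a := by apply Subtype.ext; apply AddMonoidHom.ext; intro p; rfl
  smul_add a x y := by apply Subtype.ext; apply AddMonoidHom.ext; intro p; rfl
  add_smul a b φ := by
    apply Subtype.ext; apply AddMonoidHom.ext; intro p
    change φ.1 _ = φ.1 _ + φ.1 _
    rw [← map_add]
    congr 1
    apply Subtype.ext
    exact LinearMap.comp_add _ _ _
  zero_smul φ := by
    apply Subtype.ext; apply AddMonoidHom.ext; intro p
    change φ.1 _ = 0
    rw [← map_zero φ.1]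
    congr 1
    apply Subtype.ext
    exact LinearMap.comp_zero _

theorem HM.smul_apply {N : Type} [AddCommGroup N] [Module (Cen I T) N] (s : Cen I T')
    (φ : HM I T T' N) (p : Itw I T' T) : (s • φ).1 p = φ.1 (icomp p (toI s)) := rfl

/-- The Hom functor on morphisms. -/
def HMmap (I : Set ι) (T : ι → Module.End k M) (T' : ι → Module.End k M') {N N' : Type}
    [AddCommGroup N] [Module (Cen I T) N] [AddCommGroup N'] [Module (Cen I T) N']
    (f : N →ₗ[Cen I T] N') : HM I T T' N →ₗ[Cen I T'] HM I T T' N' where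
  toFun φ := ⟨f.toAddMonoidHom.comp φ.1, fun s p => by
    change f (φ.1 _) = s • f (φ.1 p)
    rw [φ.2 s p, map_smul]⟩
  map_add' a b := by
    apply Subtype.ext; apply AddMonoidHom.ext; intro p
    exact map_add f _ _
  map_smul' a b := rfl

/-- The Hom functor. -/
def HF (I : Set ι) (T : ι → Module.End k M) (T' : ι → Module.End k M') :
    ModuleCat.{0} (Cen I T) ⥤ ModuleCat.{0} (Cen I T') where
  obj N := ModuleCat.of _ (HM I T T' N)
  map f := ModuleCat.ofHom (HMmap I T T' f.hom)

/-- unit -/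
def eta (I : Set ι) (T : ι → Module.End k M) (T' : ι → Module.End k M') (N : Type)
    [AddCommGroup N] [Module (Cen I T) N] :
    N →ₗ[Cen I T] HM I T' T (HM I T T' N) where
  toFun x := ⟨{ toFun := fun p => ⟨
                  { toFun := fun p' => ofI (icomp p' p) • x
                    map_zero' := by
                      convert zero_smul (Cen I T) x using 2
                      rfl
                    map_add' := fun a b => by
                      rw [← add_smul]
                      rfl }, fun s p' => by
                  change ofI (icomp (icomp (toI s) p') p) • x = s • (ofI (icomp p' p) • x)
                  rw [smul_smul]
                  rfl⟩
                map_zero' := by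
                  apply Subtype.ext; apply AddMonoidHom.ext; intro p'
                  change ofI (icomp p' 0) • x = (0 : N)
                  convert zero_smul (Cen I T) x using 2
                  apply Subtype.ext
                  exact LinearMap.comp_zero _
                map_add' := fun a b => by
                  apply Subtype.ext; apply AddMonoidHom.ext; intro p'
                  change ofI (icomp p' (a + b)) • x =
                    (ofI (icomp p' a) • x + ofI (icomp p' b) • x : N)
                  rw [← add_smul]
                  congr 1
                  apply Subtype.ext
                  exact LinearMap.comp_add _ _ _ }, fun s p => by
              apply Subtype.ext; apply AddMonoidHom.ext; intro p'
              rfl⟩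
  map_add' x y := by
    apply Subtype.ext; apply AddMonoidHom.ext; intro p
    apply Subtype.ext; apply AddMonoidHom.ext; intro p'
    exact smul_add _ _ _
  map_smul' s x := by
    apply Subtype.ext; apply AddMonoidHom.ext; intro p
    apply Subtype.ext; apply AddMonoidHom.ext; intro p'
    change ofI (icomp p' p) • (s • x) = ofI (icomp p' (icomp p (toI s))) • x
    rw [smul_smul]
    rfl

/-- identity of `M` factors through sums of `M'` -/
def Fac (I : Set ι) (T : ι → Module.End k M) (T' : ι → Module.End k M') : Prop :=
  ∃ (J : Type) (_ : Fintype J) (p : J → Itw I T T') (p' : J → Itw I T' T),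
    ∑ j, ((p' j).1 ∘ₗ (p j).1) = LinearMap.id

theorem Fac.trans (h : Fac I T T') (h' : Fac I T' T'') : Fac I T T'' := by
  obtain ⟨J, _, p, p', hp⟩ := h
  obtain ⟨L, _, r, r', hr⟩ := h'
  refine ⟨J × L, inferInstance, fun x => icomp (r x.2) (p x.1),
    fun x => icomp (p' x.1) (r' x.2), ?_⟩
  rw [Fintype.sum_prod_type, ← hp]
  refine Finset.sum_congr rfl fun j _ => ?_
  have : (p' j).1 ∘ₗ (∑ l, (r' l).1 ∘ₗ (r l).1) ∘ₗ (p j).1 = (p' j).1 ∘ₗ (p j).1 := by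
    rw [hr, LinearMap.id_comp]
  rw [← this]
  ext x
  simp [icomp]

theorem eta_bij (h : Fac I T T') (N : Type) [AddCommGroup N] [Module (Cen I T) N] :
    Function.Bijective (eta I T T' N) := by
  obtain ⟨J, _, p, p', hp⟩ := h
  have h1 : ∑ j, ofI (icomp (p' j) (p j)) = (1 : Cen I T) := by
    apply Subtype.ext
    rw [AddSubmonoidClass.coe_finsetSum]
    exact hp
  constructor
  · rw [injective_iff_map_eq_zero]
    intro x hx
    rw [← one_smul (Cen I T) x, ← h1, Finset.sum_smul]
    refine Finset.sum_eq_zero fun j _ => ?_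
    have := congrArg (fun φ => (φ.1 (p j)).1 (p' j)) hx
    exact this
  · intro φ
    refine ⟨∑ j, (φ.1 (p j)).1 (p' j), ?_⟩
    apply Subtype.ext; apply AddMonoidHom.ext; intro r
    apply Subtype.ext; apply AddMonoidHom.ext; intro r'
    change ofI (icomp r' r) • (∑ j, (φ.1 (p j)).1 (p' j)) = (φ.1 r).1 r'
    rw [Finset.smul_sum]
    have key : ∀ j, ofI (icomp r' r) • (φ.1 (p j)).1 (p' j)
        = (φ.1 (icomp r (toI (ofI (icomp (p' j) (p j)))))).1 r' := by
      intro j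
      rw [← (φ.1 (p j)).2]
      have := congrArg (fun ψ => ψ.1 r') (φ.2 (ofI (icomp r (p' j))) (p j))
      exact this.symm
    rw [Finset.sum_congr rfl fun j _ => key j]
    have e : r = ∑ j, icomp r (toI (ofI (icomp (p' j) (p j)))) := by
      apply Subtype.ext
      rw [AddSubmonoidClass.coe_finsetSum]
      have : r.1 ∘ₗ (∑ j, (p' j).1 ∘ₗ (p j).1) = r.1 := by rw [hp, LinearMap.comp_id]
      conv_lhs => rw [← this]
      ext x
      simp [icomp, toI, ofI]
    conv_rhs => rw [e, map_sum, AddSubmonoidClass.coe_finsetSum, AddMonoidHom.finsetSum_apply]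

/-- unit as natural iso -/
def etaIso (h : Fac I T T') : 𝟭 (ModuleCat.{0} (Cen I T)) ≅ HF I T T' ⋙ HF I T' T :=
  NatIso.ofComponents
    (fun N => (LinearEquiv.ofBijective (eta I T T' N) (eta_bij h N)).toModuleIso)
    (by
      intro N N' f
      ext x
      apply Subtype.ext; apply AddMonoidHom.ext; intro p
      apply Subtype.ext; apply AddMonoidHom.ext; intro p'
      exact (map_smul f.hom _ _).symm)

theorem morita (h : Fac I T T') (h' : Fac I T' T) :
    Nonempty (ModuleCat.{0} (Cen I T) ≌ ModuleCat.{0} (Cen I T')) :=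
  ⟨CategoryTheory.Equivalence.mk (HF I T T') (HF I T' T) (etaIso h) (etaIso h').symm⟩

end Morita
/-! ### The operators on basis vectors -/
section Ops

theorem val_eq_zero_iff {n : ℕ} (b : Fin n) : val n b = 0 ↔ b = Fin.rev b := by
  rw [Fin.ext_iff, Fin.val_rev]; unfold val; have := b.2; omega

theorem val_neg_iff {n : ℕ} (b : Fin n) : val n b < 0 ↔ b < Fin.rev b := by
  rw [Fin.lt_def, Fin.val_rev]; unfold val; have := b.2; omega

theorem KQmat_symm {k : Type*} [Field k] (Q : k) (n : ℕ) (b c : Fin n) :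
    KQmat Q n b c = KQmat Q n c b := by
  unfold KQmat
  by_cases h : c = b
  · subst h; rfl
  · have h' : ¬ b = c := fun e => h e.symm
    simp only [val_eq_zero_iff, h, h', if_false, and_false, add_zero]
    have e : b = Fin.rev c ↔ c = Fin.rev b := by
      constructor <;> (intro e; rw [e, Fin.rev_rev])
    by_cases h1 : c = Fin.rev b
    · have h2 := e.2 h1
      have n1 : ¬ c = Fin.rev c := fun e' => h' (h2.trans e'.symm)
      have n2 : ¬ b = Fin.rev b := fun e' => h (h1.trans e'.symm)
      rw [if_neg n1, if_neg n2, if_pos h2, if_pos h1]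
    · rw [if_neg h1, if_neg (fun h => h1 (e.1 h))]
      simp

theorem Rmat_symm {k : Type*} [Field k] (q : k) (n : ℕ) (b c : Fin n × Fin n) :
    Rmat q n b c = Rmat q n c b := by
  obtain ⟨b1, b2⟩ := b
  obtain ⟨c1, c2⟩ := c
  unfold Rmat
  simp only [Prod.mk.injEq]
  by_cases h : b1 = c1 ∧ b2 = c2
  · obtain ⟨rfl, rfl⟩ := h; rfl
  · have h' : ¬ (c1 = b1 ∧ c2 = b2) := fun e => h ⟨e.1.symm, e.2.symm⟩
    simp only [h, h', if_false, add_zero]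
    by_cases h2 : b1 = c2 ∧ b2 = c1
    · obtain ⟨rfl, rfl⟩ := h2
      have : b2 ≠ b1 := fun e => h ⟨e.symm, e⟩
      simp [this, this.symm]
    · have h3 : ¬ (c1 = b2 ∧ c2 = b1) := fun e => h2 ⟨e.2.symm, e.1.symm⟩
      simp [h2, h3]

variable {k : Type} [Field k]

/-- Matrix of `TB 0`. -/
def TM0 (Q : k) (n d : ℕ) (hd : 0 < d) : Matrix (Fin d → Fin n) (Fin d → Fin n) k :=
  Matrix.of fun c b =>
    if ∀ j, j ≠ (⟨0, hd⟩ : Fin d) → c j = b j then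
      KQmat Q n (c ⟨0, hd⟩) (b ⟨0, hd⟩) else 0

/-- Matrix of `TB i`. -/
def TM1 (q : k) (n d : ℕ) (i j : Fin d) : Matrix (Fin d → Fin n) (Fin d → Fin n) k :=
  Matrix.of fun c b =>
    if ∀ l, l ≠ i → l ≠ j → c l = b l then
      Rmat q n (c i, c j) (b i, b j) else 0

theorem TB_zero_eq (Q q : k) (n d : ℕ) (hd : 0 < d) :
    TB Q q n d 0 = Matrix.toLin' (TM0 Q n d hd) := by
  unfold TB
  rw [dif_pos rfl, dif_pos hd]
  rfl

theorem TB_succ_eq (Q q : k) (n d : ℕ) (i j : Fin d) (hij : (i : ℕ) + 1 = j) :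
    TB Q q n d j = Matrix.toLin' (TM1 q n d i j) := by
  have hi : i = (⟨(j : ℕ) - 1, Nat.lt_of_le_of_lt (Nat.pred_le _) j.2⟩ : Fin d) := by
    apply Fin.ext; simp; omega
  subst hi
  unfold TB
  rw [dif_neg (by omega), dif_pos j.2]
  rfl

/-- Matrix of `TB`. -/
def TM (Q q : k) (n d : ℕ) (i : ℕ) : Matrix (Fin d → Fin n) (Fin d → Fin n) k :=
  LinearMap.toMatrix' (TB Q q n d i)

theorem TM_symm (Q q : k) (n d i : ℕ) (hi : i < d) :
    (TM Q q n d i).transpose = TM Q q n d i := by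
  unfold TM
  obtain rfl | hpos := Nat.eq_zero_or_pos i
  · rw [TB_zero_eq Q q n d hi, LinearMap.toMatrix'_toLin']
    ext c b
    simp only [Matrix.transpose_apply, TM0, Matrix.of_apply]
    rw [KQmat_symm]
    simp only [eq_comm (a := b _)]
  · obtain ⟨j, rfl⟩ : ∃ j : Fin d, (j : ℕ) = i := ⟨⟨i, hi⟩, rfl⟩
    obtain ⟨l, hl⟩ : ∃ l : Fin d, (l : ℕ) + 1 = j := ⟨⟨j - 1, by omega⟩, by simp; omega⟩
    rw [TB_succ_eq Q q n d l j hl, LinearMap.toMatrix'_toLin']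
    ext c b
    simp only [Matrix.transpose_apply, TM1, Matrix.of_apply]
    rw [Rmat_symm]
    simp only [eq_comm (a := b _)]

/-- basis vector -/
abbrev ev {n d : ℕ} (b : Fin d → Fin n) : (Fin d → Fin n) → k := Pi.single b 1

theorem TB_zero_ev (Q q : k) (n d : ℕ) (hd : 0 < d) (b : Fin d → Fin n) :
    TB Q q n d 0 (ev b) =
      if b ⟨0, hd⟩ = Fin.rev (b ⟨0, hd⟩) then Q⁻¹ • ev b
      else ev (Function.update b ⟨0, hd⟩ (Fin.rev (b ⟨0, hd⟩))) +
        (if b ⟨0, hd⟩ < Fin.rev (b ⟨0, hd⟩) then Q⁻¹ - Q else 0) • ev b := by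
  rw [TB_zero_eq Q q n d hd, Matrix.toLin'_apply, Matrix.mulVec_single_one]
  ext c
  simp only [Matrix.col_apply, TM0, Matrix.of_apply, KQmat, val_eq_zero_iff, val_neg_iff]
  have e1 : ∀ x : Fin n, ((∀ j, j ≠ (⟨0, hd⟩ : Fin d) → c j = b j) ∧ c ⟨0, hd⟩ = x) ↔
      c = Function.update b ⟨0, hd⟩ x := by
    intro x
    rw [Function.eq_update_iff]
    exact and_comm
  have e2 := e1 (b ⟨0, hd⟩)
  rw [Function.update_eq_self] at e2
  have e3 := e1 (Fin.rev (b ⟨0, hd⟩))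
  by_cases hp : (∀ l, l ≠ (⟨0, hd⟩ : Fin d) → c l = b l)
  · rw [if_pos hp]
    have e2' : c = b ↔ c ⟨0, hd⟩ = b ⟨0, hd⟩ := ⟨fun h => (e2.2 h).2, fun h => e2.1 ⟨hp, h⟩⟩
    have e3' := (⟨fun h => (e3.2 h).2, fun h => e3.1 ⟨hp, h⟩⟩ :
      c = Function.update b ⟨0, hd⟩ (Fin.rev (b ⟨0, hd⟩)) ↔ c ⟨0, hd⟩ = Fin.rev (b ⟨0, hd⟩))
    split_ifs with h1 h2 h3 h4 h5 <;> simp only [Pi.smul_apply, Pi.add_apply, ev, Pi.single_apply, smul_eq_mul, e2', e3'] <;> grind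
  · rw [if_neg hp]
    have e2' : ¬ c = b := fun h => hp (e2.2 h).1
    have e3' : ¬ c = Function.update b ⟨0, hd⟩ (Fin.rev (b ⟨0, hd⟩)) := fun h => hp (e3.2 h).1
    split_ifs <;> simp [ev, e2', e3']

theorem TB_succ_ev (Q q : k) (n d : ℕ) (i j : Fin d) (hij : (i : ℕ) + 1 = j) (b : Fin d → Fin n) :
    TB Q q n d j (ev b) =
      if b i = b j then q⁻¹ • ev b
      else ev (b ∘ Equiv.swap i j) + (if b j < b i then q⁻¹ - q else 0) • ev b := by
  rw [TB_succ_eq Q q n d i j hij, Matrix.toLin'_apply, Matrix.mulVec_single_one]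
  have hne : i ≠ j := by intro h; rw [h] at hij; omega
  ext c
  simp only [Matrix.col_apply, TM1, Matrix.of_apply, Rmat, Prod.mk.injEq]
  have e2 : ((∀ l, l ≠ i → l ≠ j → c l = b l) ∧ (c i = b i ∧ c j = b j)) ↔ c = b := by
    constructor
    · rintro ⟨h1, h2, h3⟩
      ext l
      by_cases hl : l = i
      · rw [hl, h2]
      by_cases hl' : l = j
      · rw [hl', h3]
      rw [h1 l hl hl']
    · rintro rfl; simp
  have e3 : ((∀ l, l ≠ i → l ≠ j → c l = b l) ∧ (c i = b j ∧ c j = b i)) ↔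
      c = b ∘ Equiv.swap i j := by
    constructor
    · rintro ⟨h1, h2, h3⟩
      funext l
      by_cases hl : l = i
      · rw [hl, h2]; simp
      by_cases hl' : l = j
      · rw [hl', h3]; simp
      rw [h1 l hl hl']; simp [Equiv.swap_apply_of_ne_of_ne hl hl']
    · rintro rfl
      refine ⟨fun l hl hl' => by simp [Equiv.swap_apply_of_ne_of_ne hl hl'], by simp, by simp⟩
  have tri := lt_trichotomy (b i) (b j)
  by_cases hp : (∀ l, l ≠ i → l ≠ j → c l = b l)
  · rw [if_pos hp]
    have e2' := (⟨fun h => (e2.2 h).2, fun h => e2.1 ⟨hp, h⟩⟩ : c = b ↔ (c i = b i ∧ c j = b j))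
    have e3' := (⟨fun h => (e3.2 h).2, fun h => e3.1 ⟨hp, h⟩⟩ :
      c = b ∘ Equiv.swap i j ↔ (c i = b j ∧ c j = b i))
    split_ifs with h1 h2 h3 h4 h5 <;> simp only [Pi.smul_apply, Pi.add_apply, ev, Pi.single_apply, smul_eq_mul, e2', e3'] <;> grind
  · rw [if_neg hp]
    have e2' : ¬ c = b := fun h => hp (e2.2 h).1
    have e3' : ¬ c = b ∘ Equiv.swap i j := fun h => hp (e3.2 h).1
    split_ifs <;> simp [ev, e2', e3']

/-- monomial matrices -/
def Amat {m n d : ℕ} (φ : Fin m → Fin n) (α : (Fin d → Fin m) → k) :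
    Matrix (Fin d → Fin n) (Fin d → Fin m) k :=
  fun c b => if c = φ ∘ b then α b else 0

theorem Amat_ev {m n d : ℕ} (φ : Fin m → Fin n) (α : (Fin d → Fin m) → k) (b : Fin d → Fin m) :
    Matrix.toLin' (Amat φ α) (ev b) = α b • ev (φ ∘ b) := by
  rw [Matrix.toLin'_apply, Matrix.mulVec_single_one]
  ext c
  simp [Matrix.col_apply, Amat, Pi.single_apply]

theorem Amat_itw (Q q : k) (hQ : Q ≠ 0) (hq : q ≠ 0) {m n d : ℕ} (hd : 0 < d)
    (φ : Fin m → Fin n) (α : (Fin d → Fin m) → k)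
    (H1 : ∀ (b : Fin d → Fin m) (i j : Fin d), (i : ℕ) + 1 = j → b i < b j →
      (φ (b i) < φ (b j) ∧ α (b ∘ Equiv.swap i j) = α b) ∨
      (φ (b i) = φ (b j) ∧ α (b ∘ Equiv.swap i j) = q⁻¹ * α b) ∨
      (α b = 0 ∧ α (b ∘ Equiv.swap i j) = 0))
    (H0a : ∀ (b : Fin d → Fin m), b ⟨0, hd⟩ < Fin.rev (b ⟨0, hd⟩) →
      (φ (b ⟨0, hd⟩) < Fin.rev (φ (b ⟨0, hd⟩)) ∧ φ (Fin.rev (b ⟨0, hd⟩)) = Fin.rev (φ (b ⟨0, hd⟩)) ∧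
        α (Function.update b ⟨0, hd⟩ (Fin.rev (b ⟨0, hd⟩))) = α b) ∨
      (φ (b ⟨0, hd⟩) = Fin.rev (φ (b ⟨0, hd⟩)) ∧ φ (Fin.rev (b ⟨0, hd⟩)) = Fin.rev (φ (b ⟨0, hd⟩)) ∧
        α b = Q⁻¹ * α (Function.update b ⟨0, hd⟩ (Fin.rev (b ⟨0, hd⟩)))) ∨
      (α b = 0 ∧ α (Function.update b ⟨0, hd⟩ (Fin.rev (b ⟨0, hd⟩))) = 0))
    (H0b : ∀ (b : Fin d → Fin m), b ⟨0, hd⟩ = Fin.rev (b ⟨0, hd⟩) →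
      φ (b ⟨0, hd⟩) = Fin.rev (φ (b ⟨0, hd⟩)) ∨ α b = 0) :
    Matrix.toLin' (Amat φ α) ∈ Itw (Set.Iio d) (TB Q q m d) (TB Q q n d) := by
  intro i hi
  apply (Pi.basisFun k (Fin d → Fin m)).ext
  intro b
  rw [Pi.basisFun_apply]
  change Matrix.toLin' (Amat φ α) (TB Q q m d i (ev b)) =
    TB Q q n d i (Matrix.toLin' (Amat φ α) (ev b))
  rw [Amat_ev, map_smul]
  obtain rfl | hpos := Nat.eq_zero_or_pos i
  · rw [TB_zero_ev Q q m d hd, TB_zero_ev Q q n d hd]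
    have hu : φ ∘ Function.update b ⟨0, hd⟩ (Fin.rev (b ⟨0, hd⟩)) =
        Function.update (φ ∘ b) ⟨0, hd⟩ (φ (Fin.rev (b ⟨0, hd⟩))) :=
      Function.comp_update _ _ _ _
    have hself : Function.update (φ ∘ b) ⟨0, hd⟩ (φ (b ⟨0, hd⟩)) = φ ∘ b :=
      Function.update_eq_self (⟨0, hd⟩ : Fin d) (φ ∘ b)
    simp only [Function.comp_apply]
    rcases lt_trichotomy (b ⟨0, hd⟩) (Fin.rev (b ⟨0, hd⟩)) with h | h | h
    · rw [if_neg h.ne, if_pos h, map_add, map_smul, Amat_ev, Amat_ev, hu]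
      rcases H0a b h with ⟨h1, h2, h3⟩ | ⟨h1, h2, h3⟩ | ⟨h1, h2⟩
      · rw [if_neg h1.ne, if_pos h1, h2, h3, smul_add, smul_comm (α b)]
      · rw [if_pos h1, h2, ← h1, hself, h3]
        simp only [smul_smul, ← add_smul]
        congr 1
        field_simp
        ring
      · simp [h1, h2]
    · rw [if_pos h, map_smul, Amat_ev]
      rcases H0b b h with h1 | h1
      · rw [if_pos h1, smul_comm]
      · simp [h1]
    · rw [if_neg h.ne', if_neg (not_lt.2 h.le), map_add, map_smul, Amat_ev, Amat_ev, hu]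
      have hb := H0a (Function.update b ⟨0, hd⟩ (Fin.rev (b ⟨0, hd⟩)))
        (by simpa using h)
      simp only [Function.update_self, Fin.rev_rev, Function.update_idem,
        Function.update_eq_self] at hb
      rcases hb with ⟨h1, h2, h3⟩ | ⟨h1, h2, h3⟩ | ⟨h1, h2⟩
      · have h4 : Fin.rev (φ (b ⟨0, hd⟩)) = φ (Fin.rev (b ⟨0, hd⟩)) := by rw [h2, Fin.rev_rev]
        rw [← h2] at h1
        rw [if_neg (by rw [h4]; exact h1.ne'), if_neg (by rw [h4]; exact not_lt.2 h1.le), h4, h3]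
        simp
      · have h4 : Fin.rev (φ (b ⟨0, hd⟩)) = φ (Fin.rev (b ⟨0, hd⟩)) := by rw [h2, Fin.rev_rev]
        rw [← h2] at h1
        rw [if_pos (by rw [h4]; exact h1.symm), h3, h1, hself]
        simp [smul_smul, mul_comm]
      · simp [h1, h2]
  · have hi' : i < d := hi
    obtain ⟨j, rfl⟩ : ∃ j : Fin d, (j : ℕ) = i := ⟨⟨i, hi'⟩, rfl⟩
    obtain ⟨l, hl⟩ : ∃ l : Fin d, (l : ℕ) + 1 = j := ⟨⟨j - 1, by omega⟩, by simp; omega⟩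
    rw [TB_succ_ev Q q m d l j hl, TB_succ_ev Q q n d l j hl]
    simp only [Function.comp_apply]
    rcases lt_trichotomy (b l) (b j) with h | h | h
    · rw [if_neg h.ne, if_neg (not_lt.2 h.le), map_add, map_smul, Amat_ev, Amat_ev]
      rcases H1 b l j hl h with ⟨h1, h2⟩ | ⟨h1, h2⟩ | ⟨h1, h2⟩
      · rw [if_neg h1.ne, if_neg (not_lt.2 h1.le), h2]
        simp [Function.comp_assoc]
      · rw [if_pos h1, h2]
        have : φ ∘ b ∘ Equiv.swap l j = φ ∘ b := by
          funext x
          simp only [Function.comp_apply, Equiv.swap_apply_def]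
          split_ifs with e1 e2
          · rw [e1, h1]
          · rw [e2, h1]
          · rfl
        rw [this]
        simp [smul_smul, mul_comm]
      · simp [h1, h2]
    · rw [if_pos h, if_pos (by rw [h]), map_smul, Amat_ev, smul_comm]
    · rw [if_neg h.ne', if_pos h, map_add, map_smul, Amat_ev, Amat_ev]
      have hb := H1 (b ∘ Equiv.swap l j) l j hl (by simpa using h)
      have hs : (b ∘ Equiv.swap l j) ∘ Equiv.swap l j = b := by
        funext x; simp
      rw [hs] at hb
      simp only [Function.comp_apply, Equiv.swap_apply_left, Equiv.swap_apply_right] at hb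
      rcases hb with ⟨h1, h2⟩ | ⟨h1, h2⟩ | ⟨h1, h2⟩
      · rw [if_neg h1.ne', if_pos h1, h2, smul_add, smul_comm (α _) (q⁻¹ - q), Function.comp_assoc]
      · rw [if_pos h1.symm, h2]
        have : φ ∘ b ∘ Equiv.swap l j = φ ∘ b := by
          funext x
          simp only [Function.comp_apply, Equiv.swap_apply_def]
          split_ifs with e1 e2
          · rw [e1, h1]
          · rw [e2, h1]
          · rfl
        rw [this]
        simp only [smul_smul, ← add_smul]
        congr 1
        field_simp
        ring
      · simp [h1, h2]

theorem transpose_itw (Q q : k) {m n d : ℕ} (A : Matrix (Fin d → Fin n) (Fin d → Fin m) k)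
    (h : Matrix.toLin' A ∈ Itw (Set.Iio d) (TB Q q m d) (TB Q q n d)) :
    Matrix.toLin' A.transpose ∈ Itw (Set.Iio d) (TB Q q n d) (TB Q q m d) := by
  intro i hi
  have h1 := congrArg LinearMap.toMatrix' (h i hi)
  rw [LinearMap.toMatrix'_comp, LinearMap.toMatrix'_comp, LinearMap.toMatrix'_toLin'] at h1
  change A * TM Q q m d i = TM Q q n d i * A at h1
  have h2 := congrArg Matrix.transpose h1
  rw [Matrix.transpose_mul, Matrix.transpose_mul, TM_symm _ _ _ _ _ hi, TM_symm _ _ _ _ _ hi] at h2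
  apply LinearMap.toMatrix'.injective
  rw [LinearMap.toMatrix'_comp, LinearMap.toMatrix'_comp, LinearMap.toMatrix'_toLin']
  exact h2.symm

end Ops

/-! ### Relabelling -/
section Relabel

/-- letters of a word, up to sign -/
def supp {m d : ℕ} (c : Fin d → Fin m) : Finset (Fin m) :=
  Finset.univ.filter fun a => ∃ l, c l = a ∨ Fin.rev (c l) = a

theorem mem_supp {m d : ℕ} (c : Fin d → Fin m) (a : Fin m) :
    a ∈ supp c ↔ ∃ l, c l = a ∨ Fin.rev (c l) = a := by simp [supp]

theorem supp_rev {m d : ℕ} (c : Fin d → Fin m) {a : Fin m} (h : a ∈ supp c) :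
    Fin.rev a ∈ supp c := by
  rw [mem_supp] at *
  obtain ⟨l, h | h⟩ := h
  · exact ⟨l, Or.inr (by rw [h])⟩
  · exact ⟨l, Or.inl (by rw [← h, Fin.rev_rev])⟩

theorem supp_swap {m d : ℕ} (c : Fin d → Fin m) (i j : Fin d) :
    supp (c ∘ Equiv.swap i j) = supp c := by
  ext a
  rw [mem_supp, mem_supp]
  exact (Equiv.swap i j).exists_congr_left.trans (by simp)

theorem supp_update {m d : ℕ} (c : Fin d → Fin m) (i : Fin d) :
    supp (Function.update c i (Fin.rev (c i))) = supp c := by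
  ext a
  rw [mem_supp, mem_supp]
  refine exists_congr fun l => ?_
  by_cases h : l = i
  · subst h; simp [or_comm]
  · simp [h]

variable {k : Type} [Field k]

theorem exists_relabel (Q q : k) (hQ : Q ≠ 0) (hq : q ≠ 0) {m n d : ℕ} (hd : 0 < d)
    (h : ∀ c : Fin d → Fin m, ∃ φ : Fin m → Fin n, StrictMonoOn φ (supp c : Set (Fin m)) ∧
      ∀ a ∈ supp c, φ (Fin.rev a) = Fin.rev (φ a)) (S : Finset (Fin m)) :
    ∃ A : Matrix (Fin d → Fin n) (Fin d → Fin m) k,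
      Matrix.toLin' A ∈ Itw (Set.Iio d) (TB Q q m d) (TB Q q n d) ∧
      A.transpose * A = Matrix.diagonal (fun c => if supp c = S then 1 else 0) := by
  by_cases hS : ∃ c : Fin d → Fin m, supp c = S
  · obtain ⟨c, rfl⟩ := hS
    obtain ⟨φ, h1, h2⟩ := h c
    have hmem : ∀ (b : Fin d → Fin m), supp b = supp c → ∀ l, b l ∈ supp c := by
      intro b hb l
      rw [← hb, mem_supp]
      exact ⟨l, Or.inl rfl⟩
    refine ⟨Amat φ (fun b => if supp b = supp c then 1 else 0), ?_, ?_⟩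
    · apply Amat_itw Q q hQ hq hd
      · intro b i j _ hlt
        rw [supp_swap]
        by_cases hb : supp b = supp c
        · left
          exact ⟨h1 (hmem b hb i) (hmem b hb j) hlt, rfl⟩
        · right; right; simp [hb]
      · intro b hlt
        rw [supp_update]
        by_cases hb : supp b = supp c
        · left
          have h3 := h2 _ (hmem b hb ⟨0, hd⟩)
          refine ⟨?_, h3, rfl⟩
          rw [← h3]
          exact h1 (hmem b hb _) (supp_rev c (hmem b hb _)) hlt
        · right; right; simp [hb]
      · intro b he
        by_cases hb : supp b = supp c
        · left
          have h3 := h2 _ (hmem b hb ⟨0, hd⟩)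
          rw [← he] at h3
          exact h3
        · right; simp [hb]
    · ext b b'
      rw [Matrix.mul_apply, Matrix.diagonal_apply]
      simp only [Matrix.transpose_apply, Amat]
      by_cases hb : supp b = supp c
      · by_cases hb' : supp b' = supp c
        · have e : φ ∘ b' = φ ∘ b ↔ b = b' := by
            constructor
            · intro e
              funext l
              exact h1.injOn (hmem b hb l) (hmem b' hb' l) (congrFun e l).symm
            · rintro rfl; rfl
          simp [hb, hb', e]
        · have : b ≠ b' := by rintro rfl; exact hb' hb
          simp [hb', this]
      · simp [hb]
  · refine ⟨0, ?_, ?_⟩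
    · rw [map_zero]; exact AddSubgroup.zero_mem _
    · rw [Matrix.mul_zero]
      ext b b'
      rw [Matrix.diagonal_apply, if_neg (fun e => hS ⟨b, e⟩)]
      simp

theorem fac_relabel (Q q : k) (hQ : Q ≠ 0) (hq : q ≠ 0) {m n d : ℕ} (hd : 0 < d)
    (h : ∀ c : Fin d → Fin m, ∃ φ : Fin m → Fin n, StrictMonoOn φ (supp c : Set (Fin m)) ∧
      ∀ a ∈ supp c, φ (Fin.rev a) = Fin.rev (φ a)) :
    Fac (Set.Iio d) (TB Q q m d) (TB Q q n d) := by
  choose A hA hA' using exists_relabel Q q hQ hq hd h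
  refine ⟨Finset (Fin m), inferInstance, fun S => ⟨_, hA S⟩,
    fun S => ⟨_, transpose_itw Q q _ (hA S)⟩, ?_⟩
  simp only [← Matrix.toLin'_mul, hA']
  rw [← map_sum, ← Matrix.toLin'_one]
  congr 1
  ext b b'
  rw [Matrix.sum_apply, Matrix.one_apply]
  by_cases e : b = b'
  · subst e; simp
  · simp [e]

theorem fac_up (Q q : k) (hQ : Q ≠ 0) (hq : q ≠ 0) {n d : ℕ} (hd : 0 < d) (hn : 2 * d ≤ n) :
    Fac (Set.Iio d) (TB Q q (2 * d) d) (TB Q q n d) := by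
  apply fac_relabel Q q hQ hq hd
  intro c
  refine ⟨fun a => ⟨if (a : ℕ) < d then a else a + (n - 2 * d), by have := a.2; split_ifs <;> omega⟩,
    ?_, ?_⟩
  · intro a _ b _ hab
    rw [Fin.lt_def] at *
    simp only
    split_ifs <;> omega
  · intro a _
    have := a.2
    apply Fin.ext
    simp only [Fin.val_rev]
    split_ifs <;> omega

theorem fac_even (Q q : k) (hQ : Q ≠ 0) (hq : q ≠ 0) {m d : ℕ} (hd : 0 < d) (hm : Even m) :
    Fac (Set.Iio d) (TB Q q m d) (TB Q q (2 * d) d) := by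
  apply fac_relabel Q q hQ hq hd
  intro c
  obtain ⟨r, hr⟩ := hm
  let rk : Fin m → ℕ := fun a => ((supp c).filter (· < a)).card
  have rk_mono : ∀ a b, a ∈ supp c → a < b → rk a < rk b := by
    intro a b ha hab
    apply Finset.card_lt_card
    rw [Finset.ssubset_iff_of_subset]
    · exact ⟨a, by simp [ha, hab], by simp⟩
    · intro x
      simp only [Finset.mem_filter]
      exact fun h => ⟨h.1, h.2.trans hab⟩
  have rk_lt : ∀ a, a ∈ supp c → a < Fin.rev a → rk a < d := by
    intro a ha hneg
    have h1 : insert a ((supp c).filter (· < a)) ⊆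
        Finset.univ.image (fun l => min (c l) (Fin.rev (c l))) := by
      intro x hx
      have hx' : x ∈ supp c ∧ x < Fin.rev x := by
        rw [Finset.mem_insert, Finset.mem_filter] at hx
        rcases hx with rfl | ⟨h1, h2⟩
        · exact ⟨ha, hneg⟩
        · refine ⟨h1, ?_⟩
          rw [Fin.lt_def, Fin.val_rev] at *
          omega
      rw [mem_supp] at hx'
      obtain ⟨⟨l, hl⟩, hx2⟩ := hx'
      rw [Finset.mem_image]
      refine ⟨l, Finset.mem_univ _, ?_⟩
      rcases hl with rfl | rfl
      · exact min_eq_left hx2.le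
      · rw [Fin.rev_rev] at hx2
        exact min_eq_right hx2.le
    have h2 := Finset.card_le_card h1
    rw [Finset.card_insert_of_notMem (by simp)] at h2
    have h3 : (Finset.univ.image (fun l => min (c l) (Fin.rev (c l)))).card ≤ d :=
      Finset.card_image_le.trans (by simp)
    change rk a + 1 ≤ _ at h2
    omega
  let φ : Fin m → Fin (2 * d) := fun a =>
    if a < Fin.rev a then ⟨min (rk a) (d - 1), by omega⟩
    else Fin.rev ⟨min (rk (Fin.rev a)) (d - 1), by omega⟩
  have ne : ∀ a : Fin m, a ≠ Fin.rev a := by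
    intro a h
    rw [Fin.ext_iff, Fin.val_rev] at h
    have := a.2
    omega
  have φneg : ∀ a, a < Fin.rev a → a ∈ supp c → (φ a : ℕ) = rk a := by
    intro a ha hs
    have := rk_lt a hs ha
    simp only [φ, if_pos ha]
    omega
  have φrev : ∀ a, φ (Fin.rev a) = Fin.rev (φ a) := by
    intro a
    rcases lt_or_gt_of_ne (ne a) with h | h
    · have h' : ¬ Fin.rev a < Fin.rev (Fin.rev a) := by rw [Fin.rev_rev]; exact not_lt.2 h.le
      simp only [φ, if_pos h, if_neg h', Fin.rev_rev]
    · have h' : Fin.rev a < Fin.rev (Fin.rev a) := by rw [Fin.rev_rev]; exact h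
      simp only [φ, if_pos h', if_neg (not_lt.2 h.le), Fin.rev_rev]
  have φpos : ∀ a, Fin.rev a < a → a ∈ supp c → (φ a : ℕ) + rk (Fin.rev a) + 1 = 2 * d := by
    intro a ha hs
    have h1 := φneg (Fin.rev a) (by rw [Fin.rev_rev]; exact ha) (supp_rev c hs)
    have h2 := rk_lt (Fin.rev a) (supp_rev c hs) (by rw [Fin.rev_rev]; exact ha)
    rw [φrev, Fin.val_rev] at h1
    have := (φ a).2
    omega
  refine ⟨φ, ?_, fun a _ => φrev a⟩
  intro a ha b hb hab
  rw [Finset.mem_coe] at ha hb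
  rw [Fin.lt_def]
  rcases lt_or_gt_of_ne (ne a) with h | h
  · have e1 := φneg a h ha
    have l1 := rk_lt a ha h
    rcases lt_or_gt_of_ne (ne b) with h' | h'
    · have e2 := φneg b h' hb
      have := rk_mono a b ha hab
      omega
    · have e2 := φpos b h' hb
      have l2 := rk_lt (Fin.rev b) (supp_rev c hb) (by rw [Fin.rev_rev]; exact h')
      omega
  · have h' : Fin.rev b < b := by
      rw [Fin.lt_def, Fin.val_rev] at *
      omega
    have e1 := φpos a h ha
    have e2 := φpos b h' hb
    have := rk_mono (Fin.rev b) (Fin.rev a) (supp_rev c hb) (Fin.rev_lt_rev.2 hab)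
    omega

end Relabel

/-! ### From odd to even -/
section OddEven

/-- merging the two middle letters -/
def mrg (r : ℕ) (x : Fin (2 * r + 2)) : Fin (2 * r + 1) :=
  ⟨if (x : ℕ) ≤ r then x else x - 1, by have := x.2; split_ifs <;> omega⟩

/-- number of middle letters before position `l` -/
def cnt {r d : ℕ} (c : Fin d → Fin (2 * r + 1)) (l : Fin d) : ℕ :=
  ∑ l', if l' < l ∧ (c l' : ℕ) = r then 1 else 0

variable {k : Type} [Field k]

/-- local weights -/
def bet (Q q : k) (r N : ℕ) (x : Fin (2 * r + 2)) : k :=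
  if (x : ℕ) = r then Q⁻¹ * q⁻¹ ^ N else 1

/-- weights -/
def wt (Q q : k) {r d : ℕ} (b : Fin d → Fin (2 * r + 2)) : k :=
  ∏ l, bet Q q r (cnt (mrg r ∘ b) l) (b l)

theorem mrg_rev (r : ℕ) (x : Fin (2 * r + 2)) : mrg r (Fin.rev x) = Fin.rev (mrg r x) := by
  apply Fin.ext
  have := x.2
  simp only [mrg, Fin.val_rev]
  split_ifs <;> omega

theorem mrg_mid (r : ℕ) (x : Fin (2 * r + 2)) :
    (mrg r x : ℕ) = r ↔ (x : ℕ) = r ∨ (x : ℕ) = r + 1 := by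
  simp only [mrg]
  split_ifs <;> omega

theorem prod_twist {d : ℕ} (f g : Fin d → k) (i : Fin d) (x : k)
    (h : ∀ l, f l = (if l = i then x else 1) * g l) : ∏ l, f l = x * ∏ l, g l := by
  rw [Finset.prod_congr rfl fun l _ => h l, Finset.prod_mul_distrib]
  simp

theorem cnt_swap {r d : ℕ} (c : Fin d → Fin (2 * r + 1)) (i j : Fin d) (hij : (i : ℕ) + 1 = j)
    (l : Fin d) : cnt (c ∘ Equiv.swap i j) (Equiv.swap i j l) =
      if l = i then cnt c i + (if (c j : ℕ) = r then 1 else 0)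
      else if l = j then cnt c i else cnt c l := by
  have hne : i ≠ j := by intro h; rw [h] at hij; omega
  have h0 : cnt (c ∘ Equiv.swap i j) (Equiv.swap i j l) =
      ∑ l', if Equiv.swap i j l' < Equiv.swap i j l ∧ (c l' : ℕ) = r then 1 else 0 := by
    unfold cnt
    rw [← Equiv.sum_comp (Equiv.swap i j)]
    simp
  have hs : ∀ l', Equiv.swap i j l' = if l' = i then j else if l' = j then i else l' :=
    fun l' => Equiv.swap_apply_def i j l'
  rw [h0]
  unfold cnt
  split_ifs with h1 h2 h3
  · subst h1
    have : (∑ l' : Fin d, if l' = j then 1 else 0) = 1 := by simp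
    refine Eq.trans ?_ (congrArg (_ + ·) this)
    rw [← Finset.sum_add_distrib]
    refine Finset.sum_congr rfl fun l' _ => ?_
    rw [Equiv.swap_apply_left, hs]
    by_cases e1 : l' = l
    · subst e1; simp [hne]
    by_cases e2 : l' = j
    · subst e2
      have : l < l' := by rw [Fin.lt_def]; omega
      simp [e1, h2, this, this.le]
    have : l' < j ↔ l' < l := by
      rw [Fin.lt_def, Fin.lt_def]; rw [Fin.ext_iff] at e1 e2; omega
    simp [e1, e2, this]
  · subst h1
    rw [add_zero]
    refine Finset.sum_congr rfl fun l' _ => ?_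
    rw [Equiv.swap_apply_left, hs]
    by_cases e1 : l' = l
    · subst e1; simp [hne]
    by_cases e2 : l' = j
    · subst e2
      simp [h2]
    have : l' < j ↔ l' < l := by
      rw [Fin.lt_def, Fin.lt_def]; rw [Fin.ext_iff] at e1 e2; omega
    simp [e1, e2, this]
  · subst h3
    refine Finset.sum_congr rfl fun l' _ => ?_
    rw [Equiv.swap_apply_right, hs]
    by_cases e1 : l' = i
    · subst e1
      have : l' < l := by rw [Fin.lt_def]; omega
      simp [this.le]
    by_cases e2 : l' = l
    · subst e2
      have : i < l' := by rw [Fin.lt_def]; omega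
      simp [e1, this.le]
    simp [e1, e2]
  · refine Finset.sum_congr rfl fun l' _ => ?_
    rw [hs, hs, if_neg h1, if_neg h3]
    rw [Fin.ext_iff] at h1 h3
    by_cases e1 : l' = i
    · subst e1
      have : j < l ↔ l' < l := by rw [Fin.lt_def, Fin.lt_def]; omega
      simp [this]
    by_cases e2 : l' = j
    · subst e2
      have : i < l ↔ l' < l := by rw [Fin.lt_def, Fin.lt_def]; omega
      simp [e1, this]
    simp [e1, e2]

theorem cnt_succ {r d : ℕ} (c : Fin d → Fin (2 * r + 1)) (i j : Fin d) (hij : (i : ℕ) + 1 = j) :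
    cnt c j = cnt c i + (if (c i : ℕ) = r then 1 else 0) := by
  have : (if (c i : ℕ) = r then 1 else 0) = ∑ l', if l' = i ∧ (c l' : ℕ) = r then 1 else 0 := by
    rw [Finset.sum_eq_single i]
    · simp
    · intro b _ hb; simp [hb]
    · simp
  rw [this]
  unfold cnt
  rw [← Finset.sum_add_distrib]
  refine Finset.sum_congr rfl fun l' _ => ?_
  by_cases e1 : l' = i
  · subst e1
    have : l' < j := by rw [Fin.lt_def]; omega
    simp [this]
  have : l' < j ↔ l' < i := by
    rw [Fin.lt_def, Fin.lt_def]; rw [Fin.ext_iff] at e1; omega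
  simp [e1, this]

theorem wt_swap (Q q : k) {r d : ℕ} (b : Fin d → Fin (2 * r + 2)) (i j : Fin d)
    (hij : (i : ℕ) + 1 = j) (hlt : b i < b j) :
    wt Q q (b ∘ Equiv.swap i j) =
      (if mrg r (b i) = mrg r (b j) then q⁻¹ else 1) * wt Q q b := by
  have hne : j ≠ i := by intro h; rw [h] at hij; omega
  unfold wt
  rw [← Equiv.prod_comp (Equiv.swap i j)]
  apply prod_twist _ _ i
  intro l
  rw [← Function.comp_assoc, cnt_swap _ i j hij]
  simp only [Function.comp_apply, Equiv.swap_apply_self]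
  rw [Fin.lt_def] at hlt
  have mi := mrg_mid r (b i)
  have mj := mrg_mid r (b j)
  by_cases h1 : l = i
  · subst h1
    rw [if_pos rfl, if_pos rfl]
    unfold bet
    by_cases hl : (b l : ℕ) = r
    · rw [if_pos hl, if_pos hl]
      have e : (mrg r (b j) : ℕ) = r ↔ mrg r (b l) = mrg r (b j) := by
        rw [Fin.ext_iff, mi.2 (Or.inl hl)]; exact eq_comm
      simp only [e]
      split_ifs
      · rw [pow_succ]; ring
      · simp
    · rw [if_neg hl, if_neg hl, if_neg]
      · simp
      · intro h
        rw [Fin.ext_iff] at h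
        simp only [mrg] at h
        split_ifs at h <;> omega
  · rw [if_neg h1, if_neg h1, one_mul]
    by_cases h2 : l = j
    · subst h2
      rw [if_pos rfl, cnt_succ _ i l hij]
      unfold bet
      by_cases hl : (b l : ℕ) = r
      · rw [if_pos hl, if_pos hl, if_neg, add_zero]
        simp only [Function.comp_apply, mi]
        omega
      · rw [if_neg hl, if_neg hl]
    · rw [if_neg h2]

theorem wt_update (Q q : k) {r d : ℕ} (hd : 0 < d) (b : Fin d → Fin (2 * r + 2))
    (hlt : b ⟨0, hd⟩ < Fin.rev (b ⟨0, hd⟩)) :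
    wt Q q b = (if (b ⟨0, hd⟩ : ℕ) = r then Q⁻¹ else 1) *
      wt Q q (Function.update b ⟨0, hd⟩ (Fin.rev (b ⟨0, hd⟩))) := by
  unfold wt
  apply prod_twist _ _ ⟨0, hd⟩
  intro l
  have hc : cnt (mrg r ∘ Function.update b ⟨0, hd⟩ (Fin.rev (b ⟨0, hd⟩))) l =
      cnt (mrg r ∘ b) l := by
    unfold cnt
    refine Finset.sum_congr rfl fun l' _ => ?_
    by_cases h : l' = ⟨0, hd⟩
    · subst h
      have : (mrg r (Fin.rev (b ⟨0, hd⟩)) : ℕ) = r ↔ (mrg r (b ⟨0, hd⟩) : ℕ) = r := by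
        rw [mrg_mid, mrg_mid, Fin.val_rev]
        omega
      simp [this]
    · simp [h]
  rw [hc]
  by_cases h : l = ⟨0, hd⟩
  · subst h
    have h0 : cnt (mrg r ∘ b) ⟨0, hd⟩ = 0 := by
      unfold cnt
      apply Finset.sum_eq_zero
      intro l' _
      rw [if_neg]
      rintro ⟨h, -⟩
      simp [Fin.lt_def] at h
    rw [h0, Function.update_self, if_pos rfl]
    unfold bet
    rw [Fin.lt_def, Fin.val_rev] at hlt
    have : ¬ ((Fin.rev (b ⟨0, hd⟩) : Fin _) : ℕ) = r := by
      rw [Fin.val_rev]; omega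
    rw [if_neg this]
    simp
  · rw [if_neg h, one_mul, Function.update_of_ne h]

theorem merge_itw (Q q : k) (hQ : Q ≠ 0) (hq : q ≠ 0) {r d : ℕ} (hd : 0 < d) :
    Matrix.toLin' (Amat (mrg r) (wt Q q)) ∈
      Itw (Set.Iio d) (TB Q q (2 * r + 2) d) (TB Q q (2 * r + 1) d) := by
  apply Amat_itw Q q hQ hq hd
  · intro b i j hij hlt
    rw [wt_swap Q q b i j hij hlt]
    by_cases h : mrg r (b i) = mrg r (b j)
    · right; left; simp [h]
    · left
      rw [if_neg h, one_mul]
      refine ⟨?_, rfl⟩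
      rw [Fin.ext_iff] at h
      rw [Fin.lt_def] at *
      simp only [mrg] at *
      split_ifs at * <;> omega
  · intro b hlt
    have hw := wt_update Q q hd b hlt
    rw [mrg_rev]
    by_cases h : (b ⟨0, hd⟩ : ℕ) = r
    · rw [if_pos h] at hw
      right; left
      refine ⟨?_, rfl, hw⟩
      apply Fin.ext
      rw [Fin.val_rev, (mrg_mid r _).2 (Or.inl h)]
      omega
    · rw [if_neg h, one_mul] at hw
      left
      refine ⟨?_, rfl, hw.symm⟩
      rw [Fin.lt_def, Fin.val_rev] at *
      simp only [mrg]
      split_ifs <;> omega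
  · intro b h
    rw [Fin.ext_iff, Fin.val_rev] at h
    omega

theorem merge_mul (Q q : k) (hne : ∀ N : ℕ, (Q⁻¹ * q⁻¹ ^ N) ^ 2 + 1 ≠ 0) (r d : ℕ) :
    ∃ δ : (Fin d → Fin (2 * r + 1)) → k, (∀ c, δ c ≠ 0) ∧
      Amat (d := d) (mrg r) (wt Q q) * (Amat (d := d) (mrg r) (wt Q q)).transpose = Matrix.diagonal δ := by
  refine ⟨fun c => ∏ l, ∑ x, if c l = mrg r x then (bet Q q r (cnt c l) x) ^ 2 else 0, ?_, ?_⟩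
  · intro c
    rw [Finset.prod_ne_zero_iff]
    intro l _
    by_cases h : (c l : ℕ) = r
    · rw [Fintype.sum_eq_add (⟨r, by omega⟩ : Fin (2 * r + 2)) (⟨r + 1, by omega⟩)]
      · rw [if_pos, if_pos]
        · simpa [bet] using hne (cnt c l)
        · apply Fin.ext; rw [h, (mrg_mid r _).2]; simp
        · apply Fin.ext; rw [h, (mrg_mid r _).2]; simp
      · simp
      · rintro x ⟨h1, h2⟩
        rw [if_neg]
        intro e
        rw [Fin.ext_iff, h] at e
        have := (mrg_mid r x).1 e.symm
        rw [ne_eq, Fin.ext_iff] at h1 h2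
        simp only at h1 h2
        omega
    · have hcl := (c l).2
      rw [Fintype.sum_eq_single
        (⟨if (c l : ℕ) < r then (c l : ℕ) else c l + 1, by split_ifs <;> omega⟩ : Fin (2 * r + 2))]
      · rw [if_pos]
        · unfold bet
          rw [if_neg]
          · simp
          · simp only
            split_ifs <;> omega
        · apply Fin.ext
          simp only [mrg]
          split_ifs <;> omega
      · intro x hx
        rw [if_neg]
        intro e
        apply hx
        rw [Fin.ext_iff] at e ⊢
        simp only [mrg] at *
        split_ifs at * <;> omega
  · ext c c''
    rw [Matrix.mul_apply, Matrix.diagonal_apply]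
    simp only [Matrix.transpose_apply, Amat]
    by_cases h : c = c''
    · subst h
      rw [if_pos rfl, Finset.prod_univ_sum, Fintype.piFinset_univ]
      refine Finset.sum_congr rfl fun b _ => ?_
      by_cases e : c = mrg r ∘ b
      · rw [if_pos e, ← sq]
        unfold wt
        rw [← Finset.prod_pow]
        refine Finset.prod_congr rfl fun l _ => ?_
        rw [← e, if_pos (show c l = mrg r (b l) from congrFun e l)]
      · rw [if_neg e, zero_mul]
        obtain ⟨l, hl⟩ : ∃ l, c l ≠ mrg r (b l) := by
          by_contra! hc
          exact e (funext hc)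
        exact (Finset.prod_eq_zero (Finset.mem_univ l) (if_neg hl)).symm
    · rw [if_neg h]
      refine Finset.sum_eq_zero fun b _ => ?_
      by_cases e : c = mrg r ∘ b
      · rw [if_pos e, if_neg (fun e' : c'' = mrg r ∘ b => h (e.trans e'.symm)), mul_zero]
      · rw [if_neg e, zero_mul]

theorem fac_odd (Q q : k) (hQ : Q ≠ 0) (hq : q ≠ 0)
    (hne : ∀ N : ℕ, (Q⁻¹ * q⁻¹ ^ N) ^ 2 + 1 ≠ 0) (r : ℕ) {d : ℕ} (hd : 0 < d) :
    Fac (Set.Iio d) (TB Q q (2 * r + 1) d) (TB Q q (2 * r + 2) d) := by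
  obtain ⟨δ, h1, h2⟩ := merge_mul Q q hne r d
  have hG := merge_itw Q q hQ hq (r := r) hd
  have hG' := transpose_itw Q q _ hG
  have hD := Itw.comp_mem hG hG'
  rw [← Matrix.toLin'_mul, h2] at hD
  have hinv : Matrix.diagonal (fun c => (δ c)⁻¹) * Matrix.diagonal δ =
      (1 : Matrix (Fin d → Fin (2 * r + 1)) (Fin d → Fin (2 * r + 1)) k) := by
    rw [Matrix.diagonal_mul_diagonal, ← Matrix.diagonal_one]
    congr 1
    funext c
    exact inv_mul_cancel₀ (h1 c)
  have hinv' : Matrix.diagonal δ * Matrix.diagonal (fun c => (δ c)⁻¹) =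
      (1 : Matrix (Fin d → Fin (2 * r + 1)) (Fin d → Fin (2 * r + 1)) k) := by
    rw [Matrix.diagonal_mul_diagonal, ← Matrix.diagonal_one]
    congr 1
    funext c
    exact mul_inv_cancel₀ (h1 c)
  have hDi : Matrix.toLin' (Matrix.diagonal (fun c => (δ c)⁻¹)) ∈
      Itw (Set.Iio d) (TB Q q (2 * r + 1) d) (TB Q q (2 * r + 1) d) := by
    intro i hi
    have a := hD i hi
    set D := Matrix.toLin' (Matrix.diagonal δ) with hDdef
    set E := Matrix.toLin' (Matrix.diagonal (fun c => (δ c)⁻¹)) with hEdef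
    have ed : E ∘ₗ D = LinearMap.id := by
      rw [hDdef, hEdef, ← Matrix.toLin'_mul, hinv, Matrix.toLin'_one]
    have de : D ∘ₗ E = LinearMap.id := by
      rw [hDdef, hEdef, ← Matrix.toLin'_mul, hinv', Matrix.toLin'_one]
    calc E ∘ₗ TB Q q (2 * r + 1) d i
        = (E ∘ₗ TB Q q (2 * r + 1) d i) ∘ₗ (D ∘ₗ E) := by rw [de, LinearMap.comp_id]
      _ = E ∘ₗ (TB Q q (2 * r + 1) d i ∘ₗ D) ∘ₗ E := by simp only [LinearMap.comp_assoc]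
      _ = E ∘ₗ (D ∘ₗ TB Q q (2 * r + 1) d i) ∘ₗ E := by rw [a]
      _ = (E ∘ₗ D) ∘ₗ TB Q q (2 * r + 1) d i ∘ₗ E := by simp only [LinearMap.comp_assoc]
      _ = TB Q q (2 * r + 1) d i ∘ₗ E := by rw [ed, LinearMap.id_comp]
  refine ⟨Unit, inferInstance, fun _ => ⟨_, hG'⟩, fun _ => ⟨_, Itw.comp_mem hDi hG⟩, ?_⟩
  rw [Fintype.sum_unique]
  change (_ ∘ₗ _) ∘ₗ _ = _
  rw [LinearMap.comp_assoc, ← Matrix.toLin'_mul, h2, ← Matrix.toLin'_mul, hinv, Matrix.toLin'_one]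

theorem fac_all (Q q : k) (hQ : Q ≠ 0) (hq : q ≠ 0)
    (hne : ∀ N : ℕ, (Q⁻¹ * q⁻¹ ^ N) ^ 2 + 1 ≠ 0) {d m n : ℕ} (hd : 0 < d) (hn : 2 * d ≤ n) :
    Fac (Set.Iio d) (TB Q q m d) (TB Q q n d) := by
  refine Fac.trans ?_ (fac_up Q q hQ hq hd hn)
  obtain h | ⟨r, rfl⟩ := Nat.even_or_odd m
  · exact fac_even Q q hQ hq hd h
  · exact (fac_odd Q q hQ hq hne r hd).trans (fac_even Q q hQ hq hd ⟨r + 1, by ring⟩)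

end OddEven

/-- Over `ℂ` with generic `Q, q`, for all `m, n ≥ 2d` the type
B Schur algebras `S^B_{Q,q}(m; d)` and `S^B_{Q,q}(n; d)` are Morita equivalent:
their categories of modules are equivalent. -/
theorem schur_morita_generic
    (Q q : ℂ) (hQ : Q ≠ 0) (hq : q ≠ 0)
    (hgen : ∀ a b : ℤ, (a, b) ≠ (0, 0) → Q ^ a * q ^ b ≠ 1)
    (d : ℕ) (hd : 1 ≤ d) (m n : ℕ) (hm : 2 * d ≤ m) (hn : 2 * d ≤ n) :
    Nonempty (ModuleCat.{0} ↥(schurB Q q m d) ≌ ModuleCat.{0} ↥(schurB Q q n d)) := by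
  have hne : ∀ N : ℕ, (Q⁻¹ * q⁻¹ ^ N) ^ 2 + 1 ≠ 0 := by
    intro N h
    apply hgen 4 (4 * N) (by simp)
    have h1 : (Q⁻¹ * q⁻¹ ^ N) ^ 4 = 1 := by
      linear_combination ((Q⁻¹ * q⁻¹ ^ N) ^ 2 - 1) * h
    have h2 : (Q * q ^ N) ^ 4 = 1 := by
      rw [inv_pow, ← mul_inv, inv_pow, inv_eq_one] at h1
      exact h1
    rw [← h2, mul_pow, ← pow_mul]
    norm_cast
    rw [mul_comm N 4]
  exact morita (fac_all Q q hQ hq hne hd hn) (fac_all Q q hQ hq hne hd hm)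

end QSP
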